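/- Let $t \ge 0$ and let $u, v$ be functions on $\mathbb{R}^3$ such that $f := \mathcal{F}^{-1}(e^{t|\xi|}|\hat u(\xi)|) \in \dot H^1 \cap \dot H^2$. Then $\|e^{t|D|}(u\,\partial_j v)\|_{L^2(\mathbb{R}^3)} \le C\, \|e^{t|D|}u\|_{\dot H^1}^{1/2}\, \|e^{t|D|}u\|_{\dot H^2}^{1/2}\, \|e^{t|D|}|D| v\|_{L^2}$, where $C$ is an absolute constant. -/

import Mathlib

open MeasureTheory Real FourierTransform

abbrev E3 := EuclideanSpace ℝ (Fin 3)

lemma fourier_L1_L2 {f : E3 → ℂ} (hf : Integrable f) (hf2 : MemLp (𝓕 f) 2) :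
    ∃ h : MemLp f 2, 𝓕 (h.toLp f) = hf2.toLp (𝓕 f) := by
  set W : Lp ℂ 2 (volume : Measure E3) := 𝓕⁻ (hf2.toLp (𝓕 f)) with hW
  have key : ∀ᵐ x, f x = W x := by
    apply ae_eq_of_integral_contDiff_smul_eq hf.locallyIntegrable
      ((Lp.memLp W).locallyIntegrable (by norm_num))
    intro g g_smooth g_cpt
    have hg₁ : HasCompactSupport (Complex.ofRealCLM ∘ g) := g_cpt.comp_left rfl
    have hg₂ : ContDiff ℝ (⊤ : ℕ∞) (Complex.ofRealCLM ∘ g) := by fun_prop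
    set φ : SchwartzMap E3 ℂ := hg₁.toSchwartzMap hg₂ with hφ
    have h1 : ∫ x, g x • W x = (W : TemperedDistribution E3 ℂ) φ := by simp [hφ]
    have h2 : (W : TemperedDistribution E3 ℂ) φ = ∫ x, (𝓕⁻ φ) x • 𝓕 f x := by
      rw [hW, ← Lp.fourierInv_toTemperedDistribution_eq, TemperedDistribution.fourierInv_apply,
        Lp.toTemperedDistribution_apply]
      apply integral_congr_ae
      filter_upwards [hf2.coeFn_toLp] with x hx
      rw [hx]
    have h3 : ∫ x, (𝓕⁻ φ) x • 𝓕 f x = ∫ x, (𝓕 (𝓕⁻ φ)) x • f x := by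
      have := VectorFourier.integral_fourierIntegral_smul_eq_flip (L := innerₗ E3)
        (μ := volume) (ν := volume) (f := (𝓕⁻ φ : SchwartzMap E3 ℂ)) (g := f) 
        Real.continuous_fourierChar continuous_inner (SchwartzMap.integrable _) hf
      rw [flip_innerₗ] at this
      exact this.symm
    rw [h1, h2, h3, FourierTransform.fourier_fourierInv_eq]
    simp [hφ]
  have hm : MemLp f 2 := (memLp_congr_ae key).2 (Lp.memLp W)
  refine ⟨hm, ?_⟩
  have : hm.toLp f = W := by
    apply Lp.ext
    exact hm.coeFn_toLp.trans key
  rw [this, hW, FourierTransform.fourier_fourierInv_eq]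

lemma fourier_shift {v : E3 → ℂ} (a : E3) (ξ : E3) :
    𝓕 (fun x => v (x + a)) ξ = Complex.exp ((2 * π * inner ℝ a ξ : ℝ) * Complex.I) * 𝓕 v ξ := by
  have := congrFun (VectorFourier.fourierIntegral_comp_add_right Real.fourierChar volume (innerₗ E3) v a) ξ
  simp only [innerₗ_apply_apply, Circle.smul_def, Real.fourierChar_apply, smul_eq_mul] at this
  exact this

lemma fourier_cont {f : E3 → ℂ} (hf : Integrable f) : Continuous (𝓕 f) :=
  VectorFourier.fourierIntegral_continuous Real.continuous_fourierChar continuous_inner hf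

lemma fourier_dq {v : E3 → ℂ} (hv : Integrable v) (a : E3) (c : ℂ) (ξ : E3) :
    𝓕 (fun x => c * (v (x + a) - v x)) ξ
      = c * (Complex.exp ((2 * π * inner ℝ a ξ : ℝ) * Complex.I) - 1) * 𝓕 v ξ := by
  rw [mul_assoc, sub_mul, one_mul, ← fourier_shift]
  simp only [Real.fourier_eq]
  rw [← integral_sub, ← integral_const_mul]
  · congr 1; ext x; simp [Circle.smul_def]; ring
  · exact (Real.fourierIntegral_convergent_iff ξ).2 (hv.comp_add_right a)
  · exact (Real.fourierIntegral_convergent_iff ξ).2 hv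

lemma memLp_of_weighted {v : E3 → ℂ} (hv : Integrable v)
    (h : Integrable (fun ξ => ‖ξ‖ ^ 2 * ‖𝓕 v ξ‖ ^ 2)) : MemLp (𝓕 v) 2 := by
  have hc := fourier_cont hv
  rw [memLp_two_iff_integrable_sq_norm hc.aestronglyMeasurable]
  have h1 : IntegrableOn (fun ξ => ‖𝓕 v ξ‖ ^ 2) (Metric.closedBall 0 1) :=
    (Continuous.continuousOn (by fun_prop)).integrableOn_compact (isCompact_closedBall _ _)
  rw [← integrable_indicator_iff measurableSet_closedBall] at h1
  refine (h1.add h).mono' (by fun_prop) (.of_forall fun ξ => ?_)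
  by_cases hx : ξ ∈ Metric.closedBall (0 : E3) 1
  · simp [hx]; positivity
  · simp only [Pi.add_apply, Set.indicator_of_notMem hx, zero_add]
    simp at hx
    rw [Real.norm_of_nonneg (by positivity)]
    have : 1 ≤ ‖ξ‖ ^ 2 := by nlinarith
    exact le_mul_of_one_le_left (by positivity) this

lemma exp_bd (θ : ℝ) : ‖Complex.exp (θ * Complex.I) - 1‖ ≤ |θ| := by
  have := Real.norm_exp_I_mul_ofReal_sub_one_le (x := θ)
  rwa [mul_comm] at this

lemma deriv_L2 {v : E3 → ℂ} (hv : Integrable v) (hd : Differentiable ℝ v)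
    (h : Integrable (fun ξ => ‖ξ‖ ^ 2 * ‖𝓕 v ξ‖ ^ 2)) (m : E3) :
    ∃ (h1 : MemLp (fun x => fderiv ℝ v x m) 2)
      (h2 : MemLp (fun ξ => ((2 * π * inner ℝ m ξ : ℝ) : ℂ) * Complex.I * 𝓕 v ξ) 2),
      𝓕 (h1.toLp _) = h2.toLp _ := by
  have hc := fourier_cont hv
  set G : E3 → ℂ := fun ξ => ((2 * π * inner ℝ m ξ : ℝ) : ℂ) * Complex.I * 𝓕 v ξ with hG
  have hGc : Continuous G := by fun_prop
  have hGn : ∀ ξ, ‖G ξ‖ = 2 * π * |inner ℝ m ξ| * ‖𝓕 v ξ‖ := by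
    intro ξ
    simp [hG, abs_of_pos Real.pi_pos]
  have h2 : MemLp G 2 := by
    rw [memLp_two_iff_integrable_sq_norm hGc.aestronglyMeasurable]
    refine (h.const_mul ((2 * π * ‖m‖) ^ 2)).mono' (by fun_prop) (.of_forall fun ξ => ?_)
    rw [Real.norm_of_nonneg (by positivity), hGn]
    have : |inner ℝ m ξ| ≤ ‖m‖ * ‖ξ‖ := abs_real_inner_le_norm m ξ
    calc _ ≤ (2 * π * (‖m‖ * ‖ξ‖) * ‖𝓕 v ξ‖) ^ 2 := by gcongr
      _ = _ := by ring
  let r : ℕ → ℝ := fun n => 1 / ((n : ℝ) + 1)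
  have hr : ∀ n, 0 < r n := fun n => by positivity
  have hr0 : Filter.Tendsto r Filter.atTop (nhds 0) := tendsto_one_div_add_atTop_nhds_zero_nat
  have hr1 : Filter.Tendsto r Filter.atTop (nhdsWithin 0 {0}ᶜ) :=
    tendsto_nhdsWithin_iff.2 ⟨hr0, .of_forall fun n => (hr n).ne'⟩
  let D : ℕ → E3 → ℂ := fun n x => ((r n)⁻¹ : ℂ) * (v (x + r n • m) - v x)
  have hDi : ∀ n, Integrable (D n) := fun n =>
    ((hv.comp_add_right (r n • m)).sub hv).const_mul _
  have hDF : ∀ n ξ, 𝓕 (D n) ξ = ((r n)⁻¹ : ℂ) *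
      (Complex.exp ((2 * π * inner ℝ (r n • m) ξ : ℝ) * Complex.I) - 1) * 𝓕 v ξ :=
    fun n ξ => fourier_dq hv _ _ ξ
  have hDc : ∀ n, Continuous (𝓕 (D n)) := fun n => fourier_cont (hDi n)
  have hDle : ∀ n ξ, ‖𝓕 (D n) ξ‖ ≤ ‖G ξ‖ := by
    intro n ξ
    rw [hDF, hGn, norm_mul, norm_mul]
    refine mul_le_mul_of_nonneg_right ?_ (norm_nonneg _)
    have := exp_bd (2 * π * inner ℝ (r n • m) ξ)
    rw [real_inner_smul_left] at this ⊢
    have e : |2 * π * (r n * inner ℝ m ξ)| = r n * (2 * π * |inner ℝ m ξ|) := by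
      rw [abs_mul, abs_mul, abs_mul, abs_of_pos (hr n), abs_of_pos Real.pi_pos]; simp; ring
    rw [e] at this
    rw [norm_inv, Complex.norm_real, Real.norm_of_nonneg (hr n).le, inv_mul_le_iff₀ (hr n)]
    exact this
  have hDL : ∀ n, MemLp (𝓕 (D n)) 2 := fun n =>
    h2.mono (hDc n).aestronglyMeasurable (.of_forall (hDle n))
  choose hDm hDe using fun n => fourier_L1_L2 (hDi n) (hDL n)
  have hlim : ∀ ξ, Filter.Tendsto (fun n => 𝓕 (D n) ξ) Filter.atTop (nhds (G ξ)) := by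
    intro ξ
    simp only [hDF, hG]
    refine Filter.Tendsto.mul_const _ ?_
    have hder : HasDerivAt (fun s : ℝ => Complex.exp ((2 * π * inner ℝ m ξ : ℝ) * Complex.I * s))
        (((2 * π * inner ℝ m ξ : ℝ) : ℂ) * Complex.I) 0 := by
      have := (((hasDerivAt_id (0:ℝ)).ofReal_comp).const_mul
        (((2 * π * inner ℝ m ξ : ℝ) : ℂ) * Complex.I)).cexp
      simpa using this
    have := hder.tendsto_slope_zero.comp hr1
    refine this.congr fun n => ?_
    simp only [Function.comp, zero_add, real_inner_smul_left]
    simp only [Complex.real_smul, Complex.ofReal_inv, Complex.ofReal_zero, mul_zero, Complex.exp_zero]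
    congr 3
    push_cast; ring_nf
  have hconv : Filter.Tendsto (fun n => (hDL n).toLp _) Filter.atTop (nhds (h2.toLp G)) := by
    rw [Lp.tendsto_Lp_iff_tendsto_eLpNorm'']
    simp_rw [eLpNorm_eq_lintegral_rpow_enorm_toReal (p := 2) (by norm_num) (by norm_num)]
    have : Filter.Tendsto (fun n => ∫⁻ x, ‖(𝓕 (D n) - G) x‖ₑ ^ (2:ENNReal).toReal)
        Filter.atTop (nhds (∫⁻ x : E3, 0)) := by
      apply tendsto_lintegral_of_dominated_convergence' (fun x => ‖(2:ℂ) * G x‖ₑ ^ (2:ENNReal).toReal)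
      · intro n
        have := hDc n
        have h3 : Continuous (𝓕 (D n) - G) := this.sub hGc
        exact (h3.enorm.measurable.pow_const _).aemeasurable
      · intro n
        refine .of_forall fun ξ => ?_
        apply ENNReal.rpow_le_rpow _ (by simp)
        rw [enorm_le_iff_norm_le, Pi.sub_apply, norm_mul]
        have := norm_sub_le (𝓕 (D n) ξ) (G ξ)
        have := hDle n ξ
        norm_num; linarith
      · have := (h2.const_mul 2).eLpNorm_lt_top
        rw [eLpNorm_eq_lintegral_rpow_enorm_toReal (p := 2) (by norm_num) (by norm_num)] at this
        exact ((ENNReal.rpow_lt_top_iff_of_pos (by norm_num)).1 this).ne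
      · refine .of_forall fun ξ => ?_
        have h4 : Filter.Tendsto (fun n => ‖(𝓕 (D n) - G) ξ‖ₑ) Filter.atTop (nhds 0) := by
          have := ((hlim ξ).sub_const (G ξ)).enorm
          simpa using this
        have := h4.ennrpow_const (2:ENNReal).toReal
        simpa using this
    have := this.ennrpow_const (1 / (2:ENNReal).toReal)
    simpa using this
  have hconv2 : Filter.Tendsto (fun n => (hDm n).toLp (D n)) Filter.atTop
      (nhds (𝓕⁻ (h2.toLp G))) := by
    have hcont : Continuous (fun f : Lp (α := E3) ℂ 2 => 𝓕⁻ f) :=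
      (Lp.fourierTransformₗᵢ E3 ℂ).symm.continuous
    have := (hcont.tendsto _).comp hconv
    refine this.congr fun n => ?_
    simp only [Function.comp, ← hDe, FourierTransform.fourierInv_fourier_eq]
  obtain ⟨ns, hns, hae⟩ := (tendstoInMeasure_of_tendsto_Lp hconv2).exists_seq_tendsto_ae
  have key : (fun x => fderiv ℝ v x m) =ᵐ[volume] (𝓕⁻ (h2.toLp G) : Lp (α := E3) ℂ 2 volume) := by
    have hall : ∀ᵐ x, ∀ n, (hDm n).toLp (D n) x = D n x :=
      ae_all_iff.2 fun n => (hDm n).coeFn_toLp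
    filter_upwards [hae, hall] with x hx hx2
    refine tendsto_nhds_unique ?_ hx
    simp only [hx2]
    have hld : HasDerivAt (fun s : ℝ => v (x + s • m)) (fderiv ℝ v x m) 0 :=
      (hd x).hasFDerivAt.hasLineDerivAt m
    have := (hld.tendsto_slope_zero.comp hr1).comp hns.tendsto_atTop
    refine this.congr fun n => ?_
    simp [D]
  have h1 : MemLp (fun x => fderiv ℝ v x m) 2 := (memLp_congr_ae key).2 (Lp.memLp _)
  refine ⟨h1, h2, ?_⟩
  have : h1.toLp _ = 𝓕⁻ (h2.toLp G) := Lp.ext (h1.coeFn_toLp.trans key)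
  rw [this, FourierTransform.fourier_fourierInv_eq]

lemma fourier_conj_mod {u : E3 → ℂ} (ξ η : E3) :
    𝓕 (fun x => starRingEnd ℂ (u x) * (Real.fourierChar (inner ℝ x ξ) : ℂ)) η
      = starRingEnd ℂ (𝓕 u (ξ - η)) := by
  simp only [Real.fourier_eq]
  rw [← integral_conj]
  congr 1; ext x
  simp only [Circle.smul_def, smul_eq_mul, map_mul, inner_sub_right, ← Circle.coe_inv_eq_conj, 
    ← AddChar.map_neg_eq_inv]
  rw [neg_neg, sub_eq_add_neg, AddChar.map_add_eq_mul]
  push_cast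
  ring

lemma fourier_prod {u w Gw : E3 → ℂ} (hu : Integrable u) (hu2 : MemLp (𝓕 u) 2)
    (h1 : MemLp w 2) (h2 : MemLp Gw 2) (he : 𝓕 (h1.toLp w) = h2.toLp Gw) (ξ : E3) :
    𝓕 (fun x => u x * w x) ξ = ∫ η, 𝓕 u (ξ - η) * Gw η := by
  set p : E3 → ℂ := fun x => starRingEnd ℂ (u x) * (Real.fourierChar (inner ℝ x ξ) : ℂ) with hp
  have hcc : Continuous (fun x : E3 => (Real.fourierChar (inner ℝ x ξ) : ℂ)) :=
    continuous_subtype_val.comp (Real.continuous_fourierChar.comp (by fun_prop))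
  have hpi : Integrable p := by
    refine hu.mono ?_ (.of_forall fun x => ?_)
    · exact (Complex.continuous_conj.comp_aestronglyMeasurable hu.1).mul hcc.aestronglyMeasurable
    · simp only [hp, norm_mul, RCLike.norm_conj, Circle.norm_coe, mul_one, le_refl]
  have hpF : ∀ η, 𝓕 p η = starRingEnd ℂ (𝓕 u (ξ - η)) := fourier_conj_mod ξ
  have hpL : MemLp (𝓕 p) 2 := by
    have h3 : MemLp (fun η => 𝓕 u (ξ - η)) 2 :=
      hu2.comp_measurePreserving (Measure.measurePreserving_sub_left volume ξ)
    refine h3.mono (fourier_cont hpi).aestronglyMeasurable (.of_forall fun x => ?_)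
    rw [hpF]; simp
  obtain ⟨hp2, hpe⟩ := fourier_L1_L2 hpi hpL
  have := Lp.inner_fourier_eq (hp2.toLp p) (h1.toLp w)
  rw [hpe, he, L2.inner_def, L2.inner_def] at this
  have e1 : ∫ a, inner ℂ (hpL.toLp (𝓕 p) a) (h2.toLp Gw a) = ∫ η, 𝓕 u (ξ - η) * Gw η := by
    apply integral_congr_ae
    filter_upwards [hpL.coeFn_toLp, h2.coeFn_toLp] with x hx hx'
    rw [hx, hx', hpF]
    simp [mul_comm]
  have e2 : ∫ a, inner ℂ (hp2.toLp p a) (h1.toLp w a) = 𝓕 (fun x => u x * w x) ξ := by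
    rw [Real.fourier_eq]
    apply integral_congr_ae
    filter_upwards [hp2.coeFn_toLp, h1.coeFn_toLp] with x hx hx'
    rw [hx, hx', hp]
    simp only [RCLike.inner_apply, map_mul, Circle.smul_def, smul_eq_mul, Complex.conj_conj,
      ← Circle.coe_inv_eq_conj, ← AddChar.map_neg_eq_inv]
    ring
  rw [← e2, ← this, e1]

lemma cs_sq {f h : E3 → ENNReal} (hf : AEMeasurable f) (hh : AEMeasurable h) :
    (∫⁻ x, f x * h x) ^ 2 ≤ (∫⁻ x, f x ^ 2) * ∫⁻ x, h x ^ 2 := by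
  have := ENNReal.lintegral_mul_le_Lp_mul_Lq volume Real.HolderConjugate.two_two hf hh
  simp only [Pi.mul_apply, ENNReal.rpow_two] at this
  calc _ ≤ _ := pow_le_pow_left' this 2
    _ = _ := by
      rw [mul_pow, ← ENNReal.rpow_two, ← ENNReal.rpow_two, ← ENNReal.rpow_mul, ← ENNReal.rpow_mul]
      norm_num

lemma young {a b : E3 → ENNReal} (ha : Measurable a) (hb : Measurable b) :
    ∫⁻ ξ, (∫⁻ η, a (ξ - η) * b η) ^ 2 ≤ (∫⁻ ξ, a ξ) ^ 2 * ∫⁻ η, b η ^ 2 := by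
  have hpt : ∀ ξ, (∫⁻ η, a (ξ - η) * b η) ^ 2 ≤ (∫⁻ η, a η) * ∫⁻ η, a (ξ - η) * b η ^ 2 := by
    intro ξ
    have hm : Measurable (fun η => a (ξ - η)) := ha.comp (by fun_prop)
    have := cs_sq (f := fun η => a (ξ - η) ^ (1/2 : ℝ)) (h := fun η => a (ξ - η) ^ (1/2 : ℝ) * b η)
      (hm.pow_const _).aemeasurable ((hm.pow_const _).mul hb).aemeasurable
    have e : ∀ x : ENNReal, (x ^ (1/2 : ℝ)) ^ 2 = x := fun x => by
      rw [← ENNReal.rpow_two, ← ENNReal.rpow_mul]; norm_num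
    simp only [← mul_assoc, ← pow_two, mul_pow, e] at this
    rwa [lintegral_sub_left_eq_self a ξ] at this
  calc _ ≤ ∫⁻ ξ, (∫⁻ η, a η) * ∫⁻ η, a (ξ - η) * b η ^ 2 := lintegral_mono hpt
    _ = (∫⁻ η, a η) * ∫⁻ ξ, ∫⁻ η, a (ξ - η) * b η ^ 2 := by
      rw [lintegral_const_mul]
      exact Measurable.lintegral_prod_right' (f := fun p : E3 × E3 => a (p.1 - p.2) * b p.2 ^ 2)
        (by fun_prop)
    _ = (∫⁻ η, a η) * ∫⁻ η, ∫⁻ ξ, a (ξ - η) * b η ^ 2 := by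
      rw [lintegral_lintegral_swap]
      exact Measurable.aemeasurable (by unfold Function.uncurry; fun_prop)
    _ = _ := by
      have : ∀ η, ∫⁻ ξ, a (ξ - η) * b η ^ 2 = (∫⁻ ξ, a ξ) * b η ^ 2 := by
        intro η
        rw [lintegral_mul_const _ (by fun_prop), lintegral_sub_right_eq_self a η]
      simp_rw [this]
      rw [lintegral_const_mul _ (by fun_prop), pow_two, mul_assoc]

lemma kint : Integrable (fun ζ : E3 => (‖ζ‖ ^ 2 + ‖ζ‖ ^ 4)⁻¹) := by
  have := (integrable_fun_norm_addHaar (volume : Measure E3)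
    (f := fun y : ℝ => (y ^ 2 + y ^ 4)⁻¹)).2
  apply this
  simp only [finrank_euclideanSpace, Fintype.card_fin]
  refine (integrable_inv_one_add_sq.integrableOn (s := Set.Ioi 0)).congr_fun ?_ measurableSet_Ioi
  intro y hy
  have hy : 0 < y := hy
  simp only [smul_eq_mul]
  field_simp

/-- the constant -/
noncomputable def KK : ℝ := ∫ ζ : E3, (‖ζ‖ ^ 2 + ‖ζ‖ ^ 4)⁻¹

lemma KK_nonneg : 0 ≤ KK := integral_nonneg fun _ => by positivity

lemma ae_ne : ∀ᵐ ξ : E3, ξ ≠ 0 := by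
  simp [ae_iff]

lemma interpR {g : E3 → ℝ} (hg : Continuous g) (h0 : ∀ x, 0 ≤ g x)
    (hA : Integrable (fun ξ => ‖ξ‖ ^ 2 * g ξ ^ 2)) (hB : Integrable (fun ξ => ‖ξ‖ ^ 4 * g ξ ^ 2))
    {R : ℝ} (hR : 0 < R) :
    (∫⁻ ξ, ENNReal.ofReal (g ξ)) ^ 2 ≤ ENNReal.ofReal
      ((R * (∫ ξ, ‖ξ‖ ^ 2 * g ξ ^ 2) + R⁻¹ * (∫ ξ, ‖ξ‖ ^ 4 * g ξ ^ 2)) * KK) := by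
  set w : E3 → ℝ := fun ξ => R * ‖ξ‖ ^ 2 + R⁻¹ * ‖ξ‖ ^ 4 with hw
  have hwc : Continuous w := by fun_prop
  have hw0 : ∀ ξ, 0 ≤ w ξ := fun ξ => by positivity
  have h1 : ∫⁻ ξ, ENNReal.ofReal (g ξ)
      = ∫⁻ ξ, ENNReal.ofReal (g ξ * √(w ξ)) * ENNReal.ofReal ((√(w ξ))⁻¹) := by
    apply lintegral_congr_ae
    filter_upwards [ae_ne] with ξ hξ
    have hn : 0 < ‖ξ‖ := norm_pos_iff.2 hξ
    have : 0 < w ξ := by positivity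
    rw [← ENNReal.ofReal_mul (mul_nonneg (h0 _) (by positivity))]
    congr 1
    field_simp
  rw [h1]
  refine (cs_sq (Measurable.aemeasurable (by fun_prop))
    (Measurable.aemeasurable (by fun_prop))).trans ?_
  have h2 : ∫⁻ ξ, ENNReal.ofReal (g ξ * √(w ξ)) ^ 2 = ENNReal.ofReal
      (R * (∫ ξ, ‖ξ‖ ^ 2 * g ξ ^ 2) + R⁻¹ * (∫ ξ, ‖ξ‖ ^ 4 * g ξ ^ 2)) := by
    have hs : Integrable (fun ξ => R * (‖ξ‖ ^ 2 * g ξ ^ 2) + R⁻¹ * (‖ξ‖ ^ 4 * g ξ ^ 2)) :=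
      (hA.const_mul _).add (hB.const_mul _)
    rw [← integral_const_mul, ← integral_const_mul, ← integral_add (hA.const_mul _) (hB.const_mul _),
      ofReal_integral_eq_lintegral_ofReal hs
        (.of_forall fun ξ => by dsimp; positivity)]
    congr 1; ext ξ
    rw [← ENNReal.ofReal_pow (mul_nonneg (h0 _) (by positivity)), mul_pow, Real.sq_sqrt (hw0 _)]
    congr 1; simp only [hw]; ring
  have hfun : (fun ξ => (w ξ)⁻¹) =
      fun ξ => (R ^ 3)⁻¹ * (‖R⁻¹ • ξ‖ ^ 2 + ‖R⁻¹ • ξ‖ ^ 4)⁻¹ := by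
    ext ξ
    rw [← mul_inv, norm_smul, Real.norm_of_nonneg (by positivity)]
    congr 1; simp only [hw]; field_simp
  have hi : Integrable (fun ξ => (w ξ)⁻¹) := by
    rw [hfun]
    exact (kint.comp_smul (inv_pos.2 hR).ne').const_mul _
  have h3 : ∫⁻ ξ, ENNReal.ofReal ((√(w ξ))⁻¹) ^ 2 = ENNReal.ofReal KK := by
    have : ∫ ξ, (w ξ)⁻¹ = KK := by
      rw [hfun, integral_const_mul, Measure.integral_comp_smul volume
        (fun ζ : E3 => (‖ζ‖ ^ 2 + ‖ζ‖ ^ 4)⁻¹)]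
      simp only [finrank_euclideanSpace, Fintype.card_fin, smul_eq_mul, KK]
      rw [abs_of_nonneg (by positivity)]
      field_simp
    rw [← this, ofReal_integral_eq_lintegral_ofReal hi
        (.of_forall fun ξ => inv_nonneg.2 (hw0 _))]
    congr 1; ext ξ
    rw [← ENNReal.ofReal_pow (by positivity), inv_pow, Real.sq_sqrt (hw0 _)]
  rw [h2, h3, ENNReal.ofReal_mul]
  have a1 : 0 ≤ ∫ ξ, ‖ξ‖ ^ 2 * g ξ ^ 2 := integral_nonneg fun _ => by positivity
  have a2 : 0 ≤ ∫ ξ, ‖ξ‖ ^ 4 * g ξ ^ 2 := integral_nonneg fun _ => by positivity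
  positivity

lemma zero_case {g : E3 → ℝ} (k : ℕ) 
    (hA : Integrable (fun ξ => ‖ξ‖ ^ k * g ξ ^ 2)) (h : ∫ ξ, ‖ξ‖ ^ k * g ξ ^ 2 = 0) :
    ∫⁻ ξ, ENNReal.ofReal (g ξ) = 0 := by
  rw [integral_eq_zero_iff_of_nonneg (fun _ => by dsimp; positivity) hA] at h
  rw [← lintegral_zero (μ := (volume : Measure E3))]
  apply lintegral_congr_ae
  filter_upwards [h, ae_ne] with ξ h1 h2
  have : g ξ = 0 := by
    have hn : ‖ξ‖ ≠ 0 := norm_ne_zero_iff.2 h2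
    simpa [hn] using h1
  simp [this]

lemma interp {g : E3 → ℝ} (hg : Continuous g) (h0 : ∀ x, 0 ≤ g x)
    (hA : Integrable (fun ξ => ‖ξ‖ ^ 2 * g ξ ^ 2)) (hB : Integrable (fun ξ => ‖ξ‖ ^ 4 * g ξ ^ 2)) :
    (∫⁻ ξ, ENNReal.ofReal (g ξ)) ^ 2 ≤ ENNReal.ofReal
      (2 * KK * (√(∫ ξ, ‖ξ‖ ^ 2 * g ξ ^ 2) * √(∫ ξ, ‖ξ‖ ^ 4 * g ξ ^ 2))) := by
  have a1 : 0 ≤ ∫ ξ, ‖ξ‖ ^ 2 * g ξ ^ 2 := integral_nonneg fun _ => by positivity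
  have a2 : 0 ≤ ∫ ξ, ‖ξ‖ ^ 4 * g ξ ^ 2 := integral_nonneg fun _ => by positivity
  rcases a1.eq_or_lt with h | h1
  · rw [zero_case 2 hA h.symm]; simp
  rcases a2.eq_or_lt with h | h2
  · rw [zero_case 4 hB h.symm]; simp
  have hR := interpR hg h0 hA hB (div_pos (Real.sqrt_pos.2 h2) (Real.sqrt_pos.2 h1))
  refine hR.trans (le_of_eq ?_)
  congr 1
  set A := ∫ ξ, ‖ξ‖ ^ 2 * g ξ ^ 2
  set B := ∫ ξ, ‖ξ‖ ^ 4 * g ξ ^ 2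
  have sA := Real.sqrt_pos.2 h1
  have sB := Real.sqrt_pos.2 h2
  have eA := Real.sq_sqrt a1
  have eB := Real.sq_sqrt a2
  generalize √A = x at *
  generalize √B = y at *
  rw [← eA, ← eB]
  field_simp
  ring

theorem stmt8 :
    ∃ C > (0 : ℝ), ∀ (t : ℝ), 0 ≤ t → ∀ (j : Fin 3),
      ∀ u v : EuclideanSpace ℝ (Fin 3) → ℂ,
      Integrable u → Integrable v → Differentiable ℝ v →
      Integrable (fun x => u x * fderiv ℝ v x (EuclideanSpace.single j 1)) →
      Integrable (fun ξ => ‖ξ‖ ^ 2 * Real.exp (2 * t * ‖ξ‖) * ‖𝓕 u ξ‖ ^ 2) →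
      Integrable (fun ξ => ‖ξ‖ ^ 4 * Real.exp (2 * t * ‖ξ‖) * ‖𝓕 u ξ‖ ^ 2) →
      Integrable (fun ξ => ‖ξ‖ ^ 2 * Real.exp (2 * t * ‖ξ‖) * ‖𝓕 v ξ‖ ^ 2) →
      (∫⁻ ξ : EuclideanSpace ℝ (Fin 3),
          ENNReal.ofReal (Real.exp (2 * t * ‖ξ‖) *
            ‖𝓕 (fun x => u x * fderiv ℝ v x (EuclideanSpace.single j 1)) ξ‖ ^ 2)) ^ ((1 : ℝ) / 2)
        ≤ ENNReal.ofReal (C *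
            (∫ ξ : EuclideanSpace ℝ (Fin 3),
              ‖ξ‖ ^ 2 * Real.exp (2 * t * ‖ξ‖) * ‖𝓕 u ξ‖ ^ 2) ^ ((1 : ℝ) / 4) *
            (∫ ξ : EuclideanSpace ℝ (Fin 3),
              ‖ξ‖ ^ 4 * Real.exp (2 * t * ‖ξ‖) * ‖𝓕 u ξ‖ ^ 2) ^ ((1 : ℝ) / 4) *
            (∫ ξ : EuclideanSpace ℝ (Fin 3),
              ‖ξ‖ ^ 2 * Real.exp (2 * t * ‖ξ‖) * ‖𝓕 v ξ‖ ^ 2) ^ ((1 : ℝ) / 2)) := by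
  have hKK := KK_nonneg
  refine ⟨√(2 * KK) * (2 * π) + 1, by positivity, ?_⟩
  intro t ht j u v hu hv hd _ hA hB hV
  have hexp : ∀ ξ : E3, Real.exp (2 * t * ‖ξ‖) = Real.exp (t * ‖ξ‖) ^ 2 := by
    intro ξ; rw [← Real.exp_nat_mul]; congr 1; push_cast; ring
  have hexp1 : ∀ ξ : E3, 1 ≤ Real.exp (2 * t * ‖ξ‖) := fun ξ => Real.one_le_exp (by positivity)
  have huc := fourier_cont hu
  have hvc := fourier_cont hv
  have hunw : ∀ f : E3 → ℂ, Continuous (𝓕 f) →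
      Integrable (fun ξ => ‖ξ‖ ^ 2 * Real.exp (2 * t * ‖ξ‖) * ‖𝓕 f ξ‖ ^ 2) →
      Integrable (fun ξ => ‖ξ‖ ^ 2 * ‖𝓕 f ξ‖ ^ 2) := by
    intro f hf h
    refine h.mono' (by fun_prop) (.of_forall fun ξ => ?_)
    rw [Real.norm_of_nonneg (by positivity)]
    gcongr
    exact le_mul_of_one_le_right (by positivity) (hexp1 ξ)
  obtain ⟨h1, h2, he⟩ := deriv_L2 hv hd (hunw v hvc hV) (EuclideanSpace.single j 1)
  have hF := fourier_prod hu (memLp_of_weighted hu (hunw u huc hA)) h1 h2 he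
  set P : E3 → ℂ := 𝓕 (fun x => u x * fderiv ℝ v x (EuclideanSpace.single j 1)) with hP
  set g : E3 → ℝ := fun ξ => Real.exp (t * ‖ξ‖) * ‖𝓕 u ξ‖ with hg
  set b : E3 → ℝ := fun ξ => 2 * π * (Real.exp (t * ‖ξ‖) * ‖ξ‖ * ‖𝓕 v ξ‖) with hb
  have hgc : Continuous g := by fun_prop
  have hbc : Continuous b := by fun_prop
  have g0 : ∀ ξ, 0 ≤ g ξ := fun ξ => by positivity
  have b0 : ∀ ξ, 0 ≤ b ξ := fun ξ => by positivity
  have hpt : ∀ ξ, ENNReal.ofReal (Real.exp (2 * t * ‖ξ‖) * ‖P ξ‖ ^ 2) ≤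
      (∫⁻ η, ENNReal.ofReal (g (ξ - η)) * ENNReal.ofReal (b η)) ^ 2 := by
    intro ξ
    rw [hexp, ← mul_pow, ENNReal.ofReal_pow (by positivity)]
    gcongr
    rw [ENNReal.ofReal_mul (by positivity), ofReal_norm, hF]
    calc _ ≤ ENNReal.ofReal (Real.exp (t * ‖ξ‖)) * ∫⁻ η, ‖𝓕 u (ξ - η) *
            (((2 * π * inner ℝ (EuclideanSpace.single j 1) η : ℝ) : ℂ) * Complex.I * 𝓕 v η)‖ₑ := by
          gcongr; exact enorm_integral_le_lintegral_enorm _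
      _ = ∫⁻ η, ENNReal.ofReal (Real.exp (t * ‖ξ‖)) * ‖𝓕 u (ξ - η) *
            (((2 * π * inner ℝ (EuclideanSpace.single j 1) η : ℝ) : ℂ) * Complex.I * 𝓕 v η)‖ₑ := by
          rw [lintegral_const_mul']; simp
      _ ≤ _ := by
          refine lintegral_mono fun η => ?_
          rw [← ofReal_norm, ← ENNReal.ofReal_mul (by positivity), ← ENNReal.ofReal_mul (g0 _)]
          apply ENNReal.ofReal_le_ofReal
          have hin : |inner ℝ (EuclideanSpace.single j 1) η| ≤ ‖η‖ := by
            have := abs_real_inner_le_norm (EuclideanSpace.single j (1:ℝ)) η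
            simpa using this
          have htri : Real.exp (t * ‖ξ‖) ≤ Real.exp (t * ‖ξ - η‖) * Real.exp (t * ‖η‖) := by
            rw [← Real.exp_add, ← mul_add]
            apply Real.exp_le_exp.2
            gcongr
            simpa using norm_add_le (ξ - η) η
          rw [norm_mul, norm_mul, norm_mul, Complex.norm_I, Complex.norm_real, Real.norm_eq_abs,
            abs_mul, abs_of_pos Real.two_pi_pos]
          calc _ ≤ (Real.exp (t * ‖ξ - η‖) * Real.exp (t * ‖η‖)) *
                (‖𝓕 u (ξ - η)‖ * (2 * π * ‖η‖ * 1 * ‖𝓕 v η‖)) := by gcongr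
            _ = _ := by simp only [hg, hb]; ring
  have eA : (fun ξ => ‖ξ‖ ^ 2 * Real.exp (2 * t * ‖ξ‖) * ‖𝓕 u ξ‖ ^ 2) =
      fun ξ => ‖ξ‖ ^ 2 * g ξ ^ 2 := by ext ξ; rw [hexp]; simp only [hg]; ring
  have eB : (fun ξ => ‖ξ‖ ^ 4 * Real.exp (2 * t * ‖ξ‖) * ‖𝓕 u ξ‖ ^ 2) =
      fun ξ => ‖ξ‖ ^ 4 * g ξ ^ 2 := by ext ξ; rw [hexp]; simp only [hg]; ring
  rw [eA] at hA ⊢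
  rw [eB] at hB ⊢
  have a1 : 0 ≤ ∫ ξ, ‖ξ‖ ^ 2 * g ξ ^ 2 := integral_nonneg fun _ => by positivity
  have a2 : 0 ≤ ∫ ξ, ‖ξ‖ ^ 4 * g ξ ^ 2 := integral_nonneg fun _ => by positivity
  have a3 : 0 ≤ ∫ ξ : E3, ‖ξ‖ ^ 2 * Real.exp (2 * t * ‖ξ‖) * ‖𝓕 v ξ‖ ^ 2 :=
    integral_nonneg fun _ => by positivity
  have hbint : ∫⁻ η, ENNReal.ofReal (b η) ^ 2 = ENNReal.ofReal ((2 * π) ^ 2 *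
      ∫ ξ : E3, ‖ξ‖ ^ 2 * Real.exp (2 * t * ‖ξ‖) * ‖𝓕 v ξ‖ ^ 2) := by
    rw [← integral_const_mul, ofReal_integral_eq_lintegral_ofReal (hV.const_mul _)
      (.of_forall fun _ => by dsimp; positivity)]
    congr 1; ext ξ
    rw [← ENNReal.ofReal_pow (b0 _), hexp]
    congr 1; simp only [hb]; ring
  have main := (lintegral_mono hpt).trans (young (a := fun ξ => ENNReal.ofReal (g ξ))
    (b := fun ξ => ENNReal.ofReal (b ξ)) (by fun_prop) (by fun_prop))
  have main2 := main.trans (mul_le_mul_left (interp hgc g0 hA hB) _)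
  rw [hbint, ← ENNReal.ofReal_mul (by positivity)] at main2
  refine (ENNReal.rpow_le_rpow main2 (by norm_num : (0:ℝ) ≤ 1 / 2)).trans ?_
  rw [ENNReal.ofReal_rpow_of_nonneg (by positivity) (by norm_num)]
  apply ENNReal.ofReal_le_ofReal
  generalize (∫ ξ, ‖ξ‖ ^ 2 * g ξ ^ 2) = A at *
  generalize (∫ ξ, ‖ξ‖ ^ 4 * g ξ ^ 2) = B at *
  generalize (∫ ξ : E3, ‖ξ‖ ^ 2 * Real.exp (2 * t * ‖ξ‖) * ‖𝓕 v ξ‖ ^ 2) = V at *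
  have q : ∀ x : ℝ, 0 ≤ x → √(√x) = x ^ ((1:ℝ)/4) := by
    intro x hx
    rw [Real.sqrt_eq_rpow, Real.sqrt_eq_rpow, ← Real.rpow_mul hx]; norm_num
  rw [← Real.sqrt_eq_rpow, ← Real.sqrt_eq_rpow, Real.sqrt_mul (by positivity),
    Real.sqrt_mul (by positivity : 0 ≤ 2 * KK), Real.sqrt_mul (by positivity : 0 ≤ √A),
    Real.sqrt_mul (by positivity : 0 ≤ (2 * π) ^ 2), Real.sqrt_sq (by positivity), q A a1, q B a2]
  calc _ = (√(2 * KK) * (2 * π)) * A ^ ((1:ℝ)/4) * B ^ ((1:ℝ)/4) * √V := by ring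
    _ ≤ _ := by gcongr; linarith
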